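/- Let N = 2^n and 0 ≤ i < j < N, and suppose there exists a finite sequence a_0 = i, a_1, …, a_ℓ = j of integers in [0, N) such that for each m < ℓ, either (1) there exist indices u < w < n with b_k(a_m) = b_k(a_{m+1}) for all k ∉ {u, w}, b_u(a_m) = b_w(a_{m+1}) = 1, and b_w(a_m) = b_u(a_{m+1}) = 0, or (2) b_k(a_m) ≤ b_k(a_{m+1}) for all k < n. Then exactly one of the following holds: (i) p_{n-1}(i) < p_{n-1}(j), so that w(g_i) < w(g_j); or (ii) p_{n-1}(i) = p_{n-1}(j) and, with w := 2^{p_{n-1}(i)}, the minimum-weight counts satisfy S^{(n)}_{i,w} > S^{(n)}_{j,w}. -/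

import Mathlib

/-- Arıkan's 2×2 polarization kernel over GF(2). -/
def G2 : Matrix (Fin 2) (Fin 2) (ZMod 2) := !![1, 0; 1, 1]

/-- `G n` is the `n`-th Kronecker power `G₂^{⊗n}`, an `2^n × 2^n` matrix over GF(2).
The index `a * 2^n + b` corresponds to the pair `(a, b)`, so the most significant bit
comes from the leftmost Kronecker factor. -/
def G : (n : ℕ) → Matrix (Fin (2 ^ n)) (Fin (2 ^ n)) (ZMod 2)
  | 0 => 1
  | n + 1 =>
    Matrix.reindex (finProdFinEquiv.trans (finCongr (by ring)))
      (finProdFinEquiv.trans (finCongr (by ring)))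
      (Matrix.kroneckerMap (· * ·) G2 (G n))

/-- The `i`-th row `g_i` of `G n`. -/
def row (n : ℕ) (i : Fin (2 ^ n)) : Fin (2 ^ n) → ZMod 2 := G n i

/-- `bit i j` is the `j`-th bit in the binary representation of `i`. -/
def bit (i j : ℕ) : ℕ := i / 2 ^ j % 2

/-- The span of the rows `g_j` of `G n` with `j > i`. -/
def spanAbove (n : ℕ) (i : ℕ) : Submodule (ZMod 2) (Fin (2 ^ n) → ZMod 2) :=
  Submodule.span (ZMod 2) {v | ∃ j : Fin (2 ^ n), i < (j : ℕ) ∧ v = row n j}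

/-- The one-coset `C^{(n)}(0^i, 1) = g_i + ⟨g_{i+1}, …, g_{N-1}⟩`. -/
def oneCoset (n : ℕ) (i : Fin (2 ^ n)) : Set (Fin (2 ^ n) → ZMod 2) :=
  {x | ∃ v ∈ spanAbove n (i : ℕ), x = row n i + v}

/-- `S n i w` is the number of vectors of Hamming weight `w` in `C^{(n)}(0^i, 1)`. -/
noncomputable def S (n : ℕ) (i : Fin (2 ^ n)) (w : ℕ) : ℕ :=
  {x ∈ oneCoset n i | hammingNorm x = w}.ncard

/-- Concatenation of two vectors of length `2^n` into a vector of length `2^(n+1)`. -/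
def app2 {n : ℕ} (a b : Fin (2 ^ n) → ZMod 2) : Fin (2 ^ (n + 1)) → ZMod 2 :=
  fun k => Fin.append a b (finCongr (by ring : 2 ^ (n + 1) = 2 ^ n + 2 ^ n) k)

/-- One step of the partial order between synthetic channels: either (1) a swap moving a
one from a lower position `u` to a higher position `w`, or (2) a bitwise domination. -/
def polarStep (n a a' : ℕ) : Prop :=
  (∃ u w, u < w ∧ w < n ∧ (∀ k, k ≠ u → k ≠ w → bit a k = bit a' k) ∧
    bit a u = 1 ∧ bit a' w = 1 ∧ bit a w = 0 ∧ bit a' u = 0) ∨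
  (∀ k < n, bit a k ≤ bit a' k)

/-- The index of `G (n + 1)` with most significant bit `a` and remaining bits given by `k`. -/
def splitIdx (n : ℕ) : Fin 2 × Fin (2 ^ n) ≃ Fin (2 ^ (n + 1)) :=
  finProdFinEquiv.trans (finCongr (by ring))

lemma splitIdx_val (n : ℕ) (a : Fin 2) (k : Fin (2 ^ n)) :
    (splitIdx n (a, k) : ℕ) = k + 2 ^ n * a := rfl

lemma G_succ (n : ℕ) (a b : Fin 2) (i k : Fin (2 ^ n)) :
    G (n + 1) (splitIdx n (a, i)) (splitIdx n (b, k)) = G2 a b * G n i k := by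
  change Matrix.reindex (splitIdx n) (splitIdx n) (Matrix.kroneckerMap (· * ·) G2 (G n)) _ _ = _
  simp [Matrix.kroneckerMap_apply]

lemma G_mul_self (n : ℕ) : G n * G n = 1 := by
  induction n with
  | zero => simp [G]
  | succ n ih =>
    change Matrix.reindex (splitIdx n) (splitIdx n) (Matrix.kroneckerMap (· * ·) G2 (G n)) *
      Matrix.reindex (splitIdx n) (splitIdx n) (Matrix.kroneckerMap (· * ·) G2 (G n)) = 1
    have h2 : G2 * G2 = 1 := by decide
    simp only [Matrix.reindex_apply, Matrix.submatrix_mul_equiv, ← Matrix.mul_kronecker_mul, h2, ih,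
      Matrix.one_kronecker_one, Matrix.submatrix_one_equiv]

lemma vecMul_G_involutive (n : ℕ) :
    Function.Involutive (fun x : Fin (2 ^ n) → ZMod 2 => Matrix.vecMul x (G n)) := by
  intro x
  simp [Matrix.vecMul_vecMul, G_mul_self]

lemma mem_spanAbove (n i : ℕ) (x : Fin (2 ^ n) → ZMod 2) :
    x ∈ spanAbove n i ↔ ∀ k : Fin (2 ^ n), (k : ℕ) ≤ i → Matrix.vecMul x (G n) k = 0 := by
  constructor
  · intro hx
    induction hx using Submodule.span_induction with
    | mem x hx =>
      obtain ⟨j, hj, rfl⟩ := hx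
      intro k hk
      have : Matrix.vecMul (row n j) (G n) k = (G n * G n) j k := rfl
      rw [this, G_mul_self, Matrix.one_apply_ne]
      rintro rfl
      omega
    | zero => simp
    | add x y _ _ hx hy =>
      intro k hk
      simp [Matrix.add_vecMul, hx k hk, hy k hk]
    | smul c x _ hx =>
      intro k hk
      simp [Matrix.smul_vecMul, hx k hk]
  · intro h
    rw [← vecMul_G_involutive n x]
    simp only
    rw [Matrix.vecMul_eq_sum]
    refine Submodule.sum_mem _ fun k _ => ?_
    by_cases hk : (k : ℕ) ≤ i
    · simp [h k hk]
    · exact Submodule.smul_mem _ _ (Submodule.subset_span ⟨k, by omega, rfl⟩)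

lemma mem_oneCoset (n : ℕ) (i : Fin (2 ^ n)) (x : Fin (2 ^ n) → ZMod 2) :
    x ∈ oneCoset n i ↔
      Matrix.vecMul x (G n) i = 1 ∧ ∀ k < i, Matrix.vecMul x (G n) k = 0 := by
  have hrow : ∀ k, Matrix.vecMul (row n i) (G n) k = (1 : Matrix _ _ (ZMod 2)) i k := by
    intro k
    rw [← G_mul_self]
    rfl
  have hmem : x ∈ oneCoset n i ↔ x - row n i ∈ spanAbove n i := by
    constructor
    · rintro ⟨v, hv, rfl⟩
      simpa using hv
    · intro h
      exact ⟨_, h, by simp⟩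
  rw [hmem, mem_spanAbove]
  simp only [Matrix.sub_vecMul, Pi.sub_apply, hrow, sub_eq_zero]
  constructor
  · intro h
    refine ⟨by simpa using h i le_rfl, fun k hk => ?_⟩
    rw [h k hk.le, Matrix.one_apply_ne hk.ne']
  · rintro ⟨h1, h2⟩ k hk
    rcases (show k ≤ i from hk).eq_or_lt with rfl | hk
    · simpa using h1
    · rw [h2 k hk, Matrix.one_apply_ne hk.ne']

/-- The vector with halves `x` and `y`. -/
def joinVec {n : ℕ} (x y : Fin (2 ^ n) → ZMod 2) : Fin (2 ^ (n + 1)) → ZMod 2 :=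
  fun k => ![x, y] ((splitIdx n).symm k).1 ((splitIdx n).symm k).2

lemma joinVec_zero {n : ℕ} (x y : Fin (2 ^ n) → ZMod 2) (k : Fin (2 ^ n)) :
    joinVec x y (splitIdx n (0, k)) = x k := by
  simp [joinVec]

lemma joinVec_one {n : ℕ} (x y : Fin (2 ^ n) → ZMod 2) (k : Fin (2 ^ n)) :
    joinVec x y (splitIdx n (1, k)) = y k := by
  simp [joinVec]

lemma joinVec_injective {n : ℕ} {x y x' y' : Fin (2 ^ n) → ZMod 2}
    (h : joinVec x y = joinVec x' y') : x = x' ∧ y = y' := by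
  constructor <;> ext k
  · rw [← joinVec_zero x y, h, joinVec_zero]
  · rw [← joinVec_one x y, h, joinVec_one]

lemma exists_joinVec {n : ℕ} (z : Fin (2 ^ (n + 1)) → ZMod 2) : ∃ x y, z = joinVec x y := by
  refine ⟨fun k => z (splitIdx n (0, k)), fun k => z (splitIdx n (1, k)), ?_⟩
  ext k
  obtain ⟨⟨a, k⟩, rfl⟩ := (splitIdx n).surjective k
  fin_cases a
  · exact (joinVec_zero (fun k => z (splitIdx n (0, k))) _ k).symm
  · exact (joinVec_one _ (fun k => z (splitIdx n (1, k))) k).symm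

lemma sum_splitIdx {M : Type*} [AddCommMonoid M] {n : ℕ} (f : Fin (2 ^ (n + 1)) → M) :
    ∑ k, f k = ∑ k, f (splitIdx n (0, k)) + ∑ k, f (splitIdx n (1, k)) := by
  rw [← (splitIdx n).sum_comp, Fintype.sum_prod_type, Fin.sum_univ_two]

lemma hammingNorm_eq_sum {ι : Type*} [Fintype ι] (x : ι → ZMod 2) :
    hammingNorm x = ∑ k, if x k ≠ 0 then 1 else 0 := by
  rw [hammingNorm, Finset.card_filter]

lemma hammingNorm_joinVec {n : ℕ} (x y : Fin (2 ^ n) → ZMod 2) :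
    hammingNorm (joinVec x y) = hammingNorm x + hammingNorm y := by
  simp only [hammingNorm_eq_sum, sum_splitIdx, joinVec_zero, joinVec_one]

lemma row_splitIdx_zero {n : ℕ} (i : Fin (2 ^ n)) :
    row (n + 1) (splitIdx n (0, i)) = joinVec (row n i) 0 := by
  ext k
  obtain ⟨⟨a, k⟩, rfl⟩ := (splitIdx n).surjective k
  rw [row, G_succ]
  fin_cases a <;> simp [joinVec_zero, joinVec_one, G2, row]

lemma row_splitIdx_one {n : ℕ} (i : Fin (2 ^ n)) :
    row (n + 1) (splitIdx n (1, i)) = joinVec (row n i) (row n i) := by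
  ext k
  obtain ⟨⟨a, k⟩, rfl⟩ := (splitIdx n).surjective k
  rw [row, G_succ]
  fin_cases a <;> simp [joinVec_zero, joinVec_one, G2, row]

lemma vecMul_joinVec_zero {n : ℕ} (x y : Fin (2 ^ n) → ZMod 2) (k : Fin (2 ^ n)) :
    Matrix.vecMul (joinVec x y) (G (n + 1)) (splitIdx n (0, k)) =
      Matrix.vecMul (x + y) (G n) k := by
  simp [Matrix.vecMul, dotProduct, sum_splitIdx, joinVec_zero, joinVec_one, G_succ, G2, add_mul,
    Finset.sum_add_distrib]

lemma vecMul_joinVec_one {n : ℕ} (x y : Fin (2 ^ n) → ZMod 2) (k : Fin (2 ^ n)) :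
    Matrix.vecMul (joinVec x y) (G (n + 1)) (splitIdx n (1, k)) = Matrix.vecMul y (G n) k := by
  simp [Matrix.vecMul, dotProduct, sum_splitIdx, joinVec_zero, joinVec_one, G_succ, G2]

lemma joinVec_mem_oneCoset_zero {n : ℕ} (i : Fin (2 ^ n)) (x y : Fin (2 ^ n) → ZMod 2) :
    joinVec x y ∈ oneCoset (n + 1) (splitIdx n (0, i)) ↔ x + y ∈ oneCoset n i := by
  rw [mem_oneCoset, mem_oneCoset, vecMul_joinVec_zero]
  refine and_congr_right fun _ => ⟨fun h k hk => ?_, fun h k hk => ?_⟩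
  · rw [← vecMul_joinVec_zero]
    exact h _ (Fin.lt_def.2 (by rw [splitIdx_val, splitIdx_val]; exact Nat.add_lt_add_right hk _))
  · obtain ⟨⟨a, k⟩, rfl⟩ := (splitIdx n).surjective k
    rw [Fin.lt_def, splitIdx_val, splitIdx_val] at hk
    fin_cases a
    · simp only [Fin.zero_eta, vecMul_joinVec_zero]
      exact h k (by simpa using hk)
    · simp at hk
      omega

lemma joinVec_mem_oneCoset_one {n : ℕ} (i : Fin (2 ^ n)) (x y : Fin (2 ^ n) → ZMod 2) :
    joinVec x y ∈ oneCoset (n + 1) (splitIdx n (1, i)) ↔ x = y ∧ y ∈ oneCoset n i := by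
  rw [mem_oneCoset, mem_oneCoset, vecMul_joinVec_one]
  constructor
  · rintro ⟨h1, h2⟩
    refine ⟨?_, h1, fun k hk => ?_⟩
    · have h0 : Matrix.vecMul (x + y) (G n) = Matrix.vecMul 0 (G n) := by
        ext k
        rw [← vecMul_joinVec_zero, h2, Matrix.zero_vecMul, Pi.zero_apply]
        rw [Fin.lt_def, splitIdx_val, splitIdx_val]
        simp
        omega
      have := (vecMul_G_involutive n).injective h0
      rwa [CharTwo.add_eq_zero] at this
    · rw [← vecMul_joinVec_one x]
      exact h2 _ (Fin.lt_def.2 (by rw [splitIdx_val, splitIdx_val]; exact Nat.add_lt_add_right hk _))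
  · rintro ⟨rfl, h1, h2⟩
    refine ⟨h1, fun k hk => ?_⟩
    obtain ⟨⟨a, k⟩, rfl⟩ := (splitIdx n).surjective k
    rw [Fin.lt_def, splitIdx_val, splitIdx_val] at hk
    fin_cases a
    · simp [vecMul_joinVec_zero, CharTwo.add_self_eq_zero]
    · simp only [Fin.mk_one, vecMul_joinVec_one]
      exact h2 k (by simpa using hk)

lemma hammingNorm_add_add_hammingNorm {ι : Type*} [Fintype ι] (x y : ι → ZMod 2) :
    hammingNorm (x + y) + hammingNorm y =
      hammingNorm x + 2 * (Finset.univ.filter fun k => x k = 0 ∧ y k ≠ 0).card := by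
  have key : ∀ a b : ZMod 2, (if a + b ≠ 0 then 1 else 0) + (if b ≠ 0 then 1 else 0) =
      (if a ≠ 0 then 1 else 0) + 2 * (if a = 0 ∧ b ≠ 0 then 1 else 0) := by decide
  simp only [hammingNorm_eq_sum, Finset.card_filter, Finset.mul_sum, ← Finset.sum_add_distrib,
    Pi.add_apply, key]

lemma hammingNorm_add_add_hammingNorm_eq_iff {ι : Type*} [Fintype ι] {w : ℕ} (x y : ι → ZMod 2)
    (hx : w ≤ hammingNorm x) :
    hammingNorm (x + y) + hammingNorm y = w ↔
      hammingNorm x = w ∧ ∀ k, x k = 0 → y k = 0 := by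
  rw [hammingNorm_add_add_hammingNorm]
  have : (∀ k, x k = 0 → y k = 0) ↔
      (Finset.univ.filter fun k => x k = 0 ∧ y k ≠ 0).card = 0 := by
    simp [Finset.filter_eq_empty_iff]
  rw [this]
  omega

lemma card_piFinset_support {ι : Type*} [Fintype ι] [DecidableEq ι] (x : ι → ZMod 2) :
    (Fintype.piFinset fun k => if x k = 0 then ({0} : Finset (ZMod 2)) else Finset.univ).card =
      2 ^ hammingNorm x := by
  rw [Fintype.card_piFinset, hammingNorm_eq_sum, ← Finset.prod_pow_eq_pow_sum]
  refine Finset.prod_congr rfl fun k _ => ?_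
  split_ifs <;> simp_all

lemma S_splitIdx_one {n : ℕ} (i : Fin (2 ^ n)) (w : ℕ) :
    S (n + 1) (splitIdx n (1, i)) (w * 2) = S n i w := by
  rw [S, S, ← Set.ncard_image_of_injective {x ∈ oneCoset n i | hammingNorm x = w}
    (f := fun x => joinVec x x) fun x y h => (joinVec_injective h).1]
  refine congrArg Set.ncard (Set.ext fun z => ?_)
  obtain ⟨x, y, rfl⟩ := exists_joinVec z
  simp only [Set.mem_ofPred_eq, joinVec_mem_oneCoset_one, hammingNorm_joinVec, Set.mem_image]
  constructor
  · rintro ⟨⟨rfl, h⟩, hw⟩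
    exact ⟨x, ⟨h, by omega⟩, rfl⟩
  · rintro ⟨u, ⟨hu, hw⟩, h⟩
    obtain ⟨rfl, rfl⟩ := joinVec_injective h
    exact ⟨⟨rfl, hu⟩, by omega⟩

lemma S_splitIdx_zero {n : ℕ} (i : Fin (2 ^ n)) (w : ℕ)
    (hw : ∀ x ∈ oneCoset n i, w ≤ hammingNorm x) :
    S (n + 1) (splitIdx n (0, i)) w = S n i w * 2 ^ w := by
  classical
  let F : Finset (Fin (2 ^ n) → ZMod 2) :=
    Finset.univ.filter fun x => x ∈ oneCoset n i ∧ hammingNorm x = w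
  let D : Finset (Σ _ : Fin (2 ^ n) → ZMod 2, Fin (2 ^ n) → ZMod 2) :=
    F.sigma fun x => Fintype.piFinset fun k => if x k = 0 then {0} else Finset.univ
  have hD : D.card = F.card * 2 ^ w := by
    rw [Finset.card_sigma, Finset.sum_const_nat]
    intro x hx
    rw [card_piFinset_support, (Finset.mem_filter.1 hx).2.2]
  have hF : S n i w = F.card := by
    rw [S, ← Set.ncard_coe_finset]
    refine congrArg Set.ncard (Set.ext fun x => ?_)
    simp [F]
  have hinj : Function.Injective fun p : Σ _ : Fin (2 ^ n) → ZMod 2, Fin (2 ^ n) → ZMod 2 =>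
      joinVec (p.1 + p.2) p.2 := by
    rintro ⟨x, y⟩ ⟨x', y'⟩ h
    obtain ⟨h1, h2⟩ := joinVec_injective h
    simp only at h1 h2
    subst h2
    rw [add_right_cancel h1]
  rw [hF, ← hD, S, ← Set.ncard_coe_finset, ← Set.ncard_image_of_injective _ hinj]
  have hmem : ∀ x y, (⟨x, y⟩ : Σ _ : Fin (2 ^ n) → ZMod 2, Fin (2 ^ n) → ZMod 2) ∈ D ↔
      x ∈ oneCoset n i ∧ hammingNorm x = w ∧ ∀ k, x k = 0 → y k = 0 := by
    intro x y
    simp only [D, F, Finset.mem_sigma, Finset.mem_filter, Finset.mem_univ, true_and,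
      Fintype.mem_piFinset, and_assoc]
    refine and_congr_right fun _ => and_congr_right fun _ => forall_congr' fun k => ?_
    split_ifs with h <;> simp [h]
  refine congrArg Set.ncard (Set.ext fun z => ?_)
  obtain ⟨x, y, rfl⟩ := exists_joinVec z
  simp only [Set.mem_ofPred_eq, joinVec_mem_oneCoset_zero, hammingNorm_joinVec, Set.mem_image,
    Finset.mem_coe]
  have hxy : x + y + y = x := by rw [add_assoc, CharTwo.add_self_eq_zero, add_zero]
  constructor
  · rintro ⟨h, hw'⟩
    refine ⟨⟨x + y, y⟩, (hmem _ _).2 ⟨h, ?_⟩, by rw [hxy]⟩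
    rwa [← hammingNorm_add_add_hammingNorm_eq_iff _ _ (hw _ h), hxy]
  · rintro ⟨⟨u, v⟩, huv, h⟩
    obtain ⟨rfl, rfl⟩ := joinVec_injective h
    obtain ⟨h1, h2⟩ := (hmem _ _).1 huv
    simp only
    rw [hammingNorm_add_add_hammingNorm_eq_iff _ _ (hw _ h1)]
    refine ⟨?_, h2⟩
    rwa [add_assoc, CharTwo.add_self_eq_zero, add_zero]

lemma bit_splitIdx_of_lt {n s : ℕ} (a : Fin 2) (i : Fin (2 ^ n)) (hs : s < n) :
    bit (splitIdx n (a, i)) s = bit i s := by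
  obtain ⟨m, rfl⟩ := Nat.exists_eq_add_of_lt hs
  have : 2 ^ (s + m + 1) * (a : ℕ) = 2 ^ s * (2 * (2 ^ m * a)) := by ring
  rw [bit, bit, splitIdx_val, this, Nat.add_mul_div_left _ _ (by positivity),
    Nat.add_mul_mod_self_left]

lemma bit_splitIdx_self {n : ℕ} (a : Fin 2) (i : Fin (2 ^ n)) :
    bit (splitIdx n (a, i)) n = a := by
  rw [bit, splitIdx_val, Nat.add_mul_div_left _ _ (by positivity), Nat.div_eq_of_lt i.2]
  omega

lemma sum_bit_splitIdx {n z : ℕ} (a : Fin 2) (i : Fin (2 ^ n)) (hz : z ≤ n) :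
    ∑ s ∈ Finset.range z, bit (splitIdx n (a, i)) s = ∑ s ∈ Finset.range z, bit i s :=
  Finset.sum_congr rfl fun _ hs =>
    bit_splitIdx_of_lt a i ((Finset.mem_range.1 hs).trans_le hz)

lemma hammingNorm_row (n : ℕ) (i : Fin (2 ^ n)) :
    hammingNorm (row n i) = 2 ^ ∑ s ∈ Finset.range n, bit i s := by
  induction n with
  | zero =>
    have : Subsingleton (Fin (2 ^ 0)) := inferInstanceAs (Subsingleton (Fin 1))
    have h0 : row 0 i = fun _ => 1 := by
      ext k
      rw [Subsingleton.elim k i]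
      simp [row, G]
    simp [h0, hammingNorm]
  | succ n ih =>
    obtain ⟨⟨a, i⟩, rfl⟩ := (splitIdx n).surjective i
    rw [Finset.sum_range_succ, sum_bit_splitIdx a i le_rfl, bit_splitIdx_self]
    fin_cases a
    · simp [row_splitIdx_zero, hammingNorm_joinVec, ih]
    · simp [row_splitIdx_one, hammingNorm_joinVec, ih, pow_succ, mul_two]

lemma two_pow_le_hammingNorm_of_mem_oneCoset (n : ℕ) (i : Fin (2 ^ n)) (x : Fin (2 ^ n) → ZMod 2)
    (hx : x ∈ oneCoset n i) : 2 ^ ∑ s ∈ Finset.range n, bit i s ≤ hammingNorm x := by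
  induction n with
  | zero =>
    have hx0 : x ≠ 0 := by
      rintro rfl
      simpa using ((mem_oneCoset 0 i 0).1 hx).1
    simpa [Nat.one_le_iff_ne_zero] using hx0
  | succ n ih =>
    obtain ⟨⟨a, i⟩, rfl⟩ := (splitIdx n).surjective i
    obtain ⟨x, y, rfl⟩ := exists_joinVec x
    rw [Finset.sum_range_succ, sum_bit_splitIdx a i le_rfl, bit_splitIdx_self,
      hammingNorm_joinVec]
    fin_cases a
    · have h := ih i _ ((joinVec_mem_oneCoset_zero i x y).1 hx)
      have h2 := hammingNorm_add_add_hammingNorm (x + y) y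
      rw [add_assoc, CharTwo.add_self_eq_zero, add_zero] at h2
      simp only [add_zero]
      omega
    · obtain ⟨rfl, h⟩ := (joinVec_mem_oneCoset_one i x y).1 hx
      have := ih i _ h
      simp only [pow_succ]
      omega

lemma S_two_pow (n : ℕ) (i : Fin (2 ^ n)) :
    S n i (2 ^ ∑ s ∈ Finset.range n, bit i s) =
      2 ^ ∑ z ∈ Finset.range n, (1 - bit i z) * 2 ^ ∑ s ∈ Finset.range z, bit i s := by
  induction n with
  | zero =>
    have : Subsingleton (Fin (2 ^ 0)) := inferInstanceAs (Subsingleton (Fin 1))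
    have h : {x ∈ oneCoset 0 i | hammingNorm x = 1} = {fun _ => 1} := by
      ext x
      simp only [Set.mem_ofPred_eq, mem_oneCoset, Set.mem_singleton_iff, G, Matrix.vecMul_one]
      constructor
      · rintro ⟨⟨h, -⟩, -⟩
        ext k
        rw [Subsingleton.elim k i, h]
      · rintro rfl
        exact ⟨⟨rfl, fun k hk => absurd (Subsingleton.elim k i) hk.ne⟩, by simp [hammingNorm]⟩
    rw [Finset.sum_range_zero, Finset.sum_range_zero, pow_zero, S, h, Set.ncard_singleton]
  | succ n ih =>
    obtain ⟨⟨a, i⟩, rfl⟩ := (splitIdx n).surjective i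
    have hsum : ∑ z ∈ Finset.range n, (1 - bit (splitIdx n (a, i)) z) *
          2 ^ ∑ s ∈ Finset.range z, bit (splitIdx n (a, i)) s =
        ∑ z ∈ Finset.range n, (1 - bit i z) * 2 ^ ∑ s ∈ Finset.range z, bit i s :=
      Finset.sum_congr rfl fun z hz => by
        have hz := Finset.mem_range.1 hz
        rw [bit_splitIdx_of_lt a i hz, sum_bit_splitIdx a i hz.le]
    rw [Finset.sum_range_succ, Finset.sum_range_succ _ n, hsum, sum_bit_splitIdx a i le_rfl,
      bit_splitIdx_self]
    fin_cases a
    · simp only [Fin.zero_eta, add_zero, Nat.sub_zero, one_mul]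
      rw [S_splitIdx_zero _ _ (two_pow_le_hammingNorm_of_mem_oneCoset n i), ih, pow_add]
    · simp only [Fin.mk_one, Nat.sub_self, zero_mul, add_zero]
      rw [pow_succ 2 (∑ s ∈ Finset.range n, bit i s), S_splitIdx_one, ih]

lemma bit_le_one (i s : ℕ) : bit i s ≤ 1 := by
  rw [bit]
  omega

lemma sum_zeros_add_two_pow (n i : ℕ) :
    ∑ z ∈ Finset.range n, (1 - bit i z) * 2 ^ ∑ s ∈ Finset.range z, bit i s +
        2 ^ ∑ s ∈ Finset.range n, bit i s =
      ∑ z ∈ Finset.range n, 2 ^ ∑ s ∈ Finset.range z, bit i s + 1 := by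
  induction n with
  | zero => simp
  | succ n ih =>
    rw [Finset.sum_range_succ, Finset.sum_range_succ _ n, Finset.sum_range_succ _ n, pow_add]
    rcases Nat.le_one_iff_eq_zero_or_eq_one.1 (bit_le_one i n) with h | h <;> rw [h] <;> omega

lemma polarStep.sum_Ico_le {n a a' : ℕ} (h : polarStep n a a') (z : ℕ) :
    ∑ s ∈ Finset.Ico z n, bit a s ≤ ∑ s ∈ Finset.Ico z n, bit a' s := by
  rcases h with ⟨u, w, huw, hwn, heq, h1, h2, h3, h4⟩ | h
  · have key : ∑ s ∈ Finset.Ico z n, (bit a s + if s = w then 1 else 0) =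
        ∑ s ∈ Finset.Ico z n, (bit a' s + if s = u then 1 else 0) := by
      refine Finset.sum_congr rfl fun s _ => ?_
      by_cases hu : s = u
      · subst hu
        simp [h1, h4, huw.ne]
      · by_cases hw : s = w
        · subst hw
          simp [h2, h3, hu]
        · simp [hu, hw, heq s hu hw]
    simp only [Finset.sum_add_distrib, Finset.sum_ite_eq', Finset.mem_Ico] at key
    split_ifs at key <;> omega
  · exact Finset.sum_le_sum fun s hs => h s (Finset.mem_Ico.1 hs).2

lemma eq_of_bit_eq {n i j : ℕ} (hi : i < 2 ^ n) (hj : j < 2 ^ n)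
    (h : ∀ s < n, bit i s = bit j s) : i = j := by
  refine Nat.eq_of_testBit_eq fun s => ?_
  by_cases hs : s < n
  · have := h s hs
    rw [bit, bit] at this
    rw [Nat.testBit_eq_decide_div_mod_eq, Nat.testBit_eq_decide_div_mod_eq, this]
  · have hle : 2 ^ n ≤ 2 ^ s := Nat.pow_le_pow_right (by norm_num) (by omega)
    rw [Nat.testBit_lt_two_pow (hi.trans_le hle), Nat.testBit_lt_two_pow (hj.trans_le hle)]

/-- If `W^{(i)}_N` is degraded w.r.t. `W^{(j)}_N` (via a partial-order chain)
with `i < j`, then either `p_{n-1}(i) < p_{n-1}(j)`, so `w(g_i) < w(g_j)`, or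
`p_{n-1}(i) = p_{n-1}(j)` and, with `w := 2^{p_{n-1}(i)}`, `S^{(n)}_{i,w} > S^{(n)}_{j,w}`.
(The two alternatives are mutually exclusive, so exactly one of them holds.) -/
theorem stmt_12 (n : ℕ) (i j : ℕ) (hi : i < 2 ^ n) (hj : j < 2 ^ n) (hij : i < j)
    (l : ℕ) (a : ℕ → ℕ) (ha : ∀ m ≤ l, a m < 2 ^ n) (h0 : a 0 = i) (hl : a l = j)
    (hstep : ∀ m < l, polarStep n (a m) (a (m + 1))) :
    (∑ s ∈ Finset.range n, bit i s < ∑ s ∈ Finset.range n, bit j s ∧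
      hammingNorm (row n ⟨i, hi⟩) < hammingNorm (row n ⟨j, hj⟩)) ∨
    (∑ s ∈ Finset.range n, bit i s = ∑ s ∈ Finset.range n, bit j s ∧
      S n ⟨j, hj⟩ (2 ^ (∑ s ∈ Finset.range n, bit i s)) <
        S n ⟨i, hi⟩ (2 ^ (∑ s ∈ Finset.range n, bit i s))) := by
  have hT : ∀ m ≤ l, ∀ z,
      ∑ s ∈ Finset.Ico z n, bit i s ≤ ∑ s ∈ Finset.Ico z n, bit (a m) s := by
    intro m
    induction m with
    | zero => simp [h0]
    | succ m ih => exact fun hm z => (ih (by omega) z).trans ((hstep m hm).sum_Ico_le z)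
  replace hT := hT l le_rfl
  rw [hl] at hT
  have hp := hT 0
  rw [← Finset.range_eq_Ico] at hp
  rcases hp.lt_or_eq with hlt | heq
  · left
    refine ⟨hlt, ?_⟩
    rw [hammingNorm_row, hammingNorm_row]
    exact Nat.pow_lt_pow_right (by norm_num) hlt
  · right
    refine ⟨heq, ?_⟩
    have hSi := S_two_pow n ⟨i, hi⟩
    have hSj := S_two_pow n ⟨j, hj⟩
    simp only at hSi hSj
    rw [hSi, heq, hSj]
    refine Nat.pow_lt_pow_right (by norm_num) ?_
    have hP : ∀ z ≤ n, ∑ s ∈ Finset.range z, bit j s ≤ ∑ s ∈ Finset.range z, bit i s := by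
      intro z hz
      have hi' := Finset.sum_range_add_sum_Ico (bit i) hz
      have hj' := Finset.sum_range_add_sum_Ico (bit j) hz
      have := hT z
      omega
    have hne : ∃ z < n, ∑ s ∈ Finset.range z, bit j s ≠ ∑ s ∈ Finset.range z, bit i s := by
      by_contra! hall
      refine hij.ne (eq_of_bit_eq hi hj fun s hs => ?_)
      have hs0 := hall s hs
      have hs1 : ∑ s ∈ Finset.range (s + 1), bit j s = ∑ s ∈ Finset.range (s + 1), bit i s := by
        rcases (Nat.succ_le_of_lt hs).lt_or_eq with h | h
        · exact hall _ h
        · rw [← Nat.succ_eq_add_one, h, heq]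
      rw [Finset.sum_range_succ, Finset.sum_range_succ] at hs1
      omega
    have hlt : ∑ z ∈ Finset.range n, 2 ^ ∑ s ∈ Finset.range z, bit j s <
        ∑ z ∈ Finset.range n, 2 ^ ∑ s ∈ Finset.range z, bit i s := by
      obtain ⟨z, hz, hzne⟩ := hne
      refine Finset.sum_lt_sum (fun z hz => ?_) ⟨z, Finset.mem_range.2 hz, ?_⟩
      · exact Nat.pow_le_pow_right (by norm_num) (hP z (Finset.mem_range.1 hz).le)
      · exact Nat.pow_lt_pow_right (by norm_num) ((hP z hz.le).lt_of_ne hzne)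
    have ei := sum_zeros_add_two_pow n i
    have ej := sum_zeros_add_two_pow n j
    rw [heq] at ei
    omega
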